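/- arXiv:2005.00852 — 8 statements merged into one kernel-verified Lean document; each statement's English description precedes it below -/
import Mathlib

section
/- For every real number b > 3 and every ε with 0 < ε < 1, the quantity (1 − 3/b)·(1 − ε)^(−2)·ε·b − 6·(1 − ε)^(−1) + b·log(1 − ε) − b·log(1 − 3/b) + 3·(1 − 3/b)^(−1) is nonnegative. -/
theorem fene_p_fb_nonneg (b ε : ℝ) (hb : 3 < b) (hε0 : 0 < ε) (hε1 : ε < 1) :
    0 ≤ (1 - 3 / b) * (1 - ε) ^ (-2 : ℤ) * ε * b - 6 * (1 - ε) ^ (-1 : ℤ)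
      + b * Real.log (1 - ε) - b * Real.log (1 - 3 / b) + 3 * (1 - 3 / b) ^ (-1 : ℤ) := by
  have hb0 : 0 < b := by linarith
  obtain ⟨u, hu⟩ : ∃ u, u = 1 - 3 / b := ⟨_, rfl⟩
  obtain ⟨t, ht⟩ : ∃ t, t = 1 - ε := ⟨_, rfl⟩
  have hu0 : 0 < u := by
    rw [hu, sub_pos, div_lt_one hb0]
    exact hb
  have ht0 : 0 < t := by linarith
  have hε : ε = 1 - t := by linarith
  have h3 : b * (1 - u) = 3 := by
    rw [hu]
    field_simp
    ring
  have hlog : Real.log u - Real.log t ≤ u / t - 1 := by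
    rw [← Real.log_div hu0.ne' ht0.ne']
    exact Real.log_le_sub_one_of_pos (div_pos hu0 ht0)
  have hsq : 0 ≤ (1 - u / t) ^ 2 / u := by positivity
  rw [← hu, ← ht, hε]
  have key : u * t ^ (-2 : ℤ) * (1 - t) * b - 6 * t ^ (-1 : ℤ)
      + b * Real.log t - b * Real.log u + 3 * u ^ (-1 : ℤ)
      = b * ((1 - u / t) ^ 2 / u + (u / t - 1 - (Real.log u - Real.log t))) := by
    have h6 : (6 : ℝ) = 2 * (b * (1 - u)) := by linarith
    rw [h6, ← h3, zpow_neg, zpow_neg, zpow_neg, zpow_one, zpow_one, zpow_ofNat]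
    field_simp
    ring
  rw [key]
  exact mul_nonneg hb0.le (by linarith)
end

section
/- Let B be a symmetric positive definite real 3×3 matrix. Then Tr(B) − 3 − log(det B) ≤ Tr(B − 2·I + B⁻¹), i.e. the inequality φ₁(B) ≤ C·(∂φ₁/∂B : f(B)) holds for the Oldroyd-B model with constant C = 1. -/
theorem Matrix.PosDef.log_det_le_trace_sub_card {n : Type*} [Fintype n] [DecidableEq n]
    {A : Matrix n n ℝ} (hA : A.PosDef) : Real.log A.det ≤ A.trace - Fintype.card n := by
  have hdet : A.det = ∏ i, hA.isHermitian.eigenvalues i := by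
    simpa using hA.isHermitian.det_eq_prod_eigenvalues
  have htr : A.trace = ∑ i, hA.isHermitian.eigenvalues i := by
    simpa using hA.isHermitian.trace_eq_sum_eigenvalues
  rw [hdet, htr, Real.log_prod fun i _ => (hA.eigenvalues_pos i).ne']
  calc ∑ i, Real.log (hA.isHermitian.eigenvalues i)
      ≤ ∑ i, (hA.isHermitian.eigenvalues i - 1) :=
        Finset.sum_le_sum fun i _ => Real.log_le_sub_one_of_pos (hA.eigenvalues_pos i)
    _ = ∑ i, hA.isHermitian.eigenvalues i - Fintype.card n := by simp

theorem oldroyd_b_stability_inequality (B : Matrix (Fin 3) (Fin 3) ℝ) (hB : B.PosDef) :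
    B.trace - 3 - Real.log B.det ≤ (B - 2 • (1 : Matrix (Fin 3) (Fin 3) ℝ) + B⁻¹).trace := by
  have h := hB.inv.log_det_le_trace_sub_card
  rw [Matrix.det_nonsing_inv, Ring.inverse_eq_inv', Real.log_inv, Fintype.card_fin] at h
  rw [Matrix.trace_add, Matrix.trace_sub, Matrix.trace_smul, Matrix.trace_one, Fintype.card_fin]
  norm_num at h ⊢
  linarith
end

section
/- Let α be a real number with 0 < α < 1 and let B be a symmetric positive definite real 3×3 matrix. Then Tr(α·B² + (1 − 3α)·B − (2 − 3α)·I + (1 − α)·B⁻¹) ≥ 0, with equality if and only if B is the identity matrix I. -/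
open Matrix in
/-- The Giesekus entropy production splits into two manifestly nonnegative quadratic terms. -/
theorem giesekus_entropy_production_eq {n : Type*} [Fintype n] [DecidableEq n] (α : ℝ)
    {B : Matrix n n ℝ} (hB : B.PosDef) :
    α • B ^ 2 + (1 - 3 * α) • B - (2 - 3 * α) • (1 : Matrix n n ℝ) + (1 - α) • B⁻¹
      = α • ((B - 1)ᴴ * (B - 1)) + (1 - α) • ((B - 1)ᴴ * B⁻¹ * (B - 1)) := by
  have hdet : IsUnit B.det := hB.det_pos.ne'.isUnit
  have hM : (B - 1)ᴴ = B - 1 := by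
    rw [conjTranspose_sub, hB.isHermitian.eq, conjTranspose_one]
  have hmul : (B - 1) * B⁻¹ * (B - 1) = B - 1 - 1 + B⁻¹ := by
    rw [sub_mul, mul_nonsing_inv _ hdet, one_mul, sub_mul, one_mul, mul_sub,
      nonsing_inv_mul _ hdet, mul_one]
    abel
  rw [hM, hmul, show (B - 1) * (B - 1) = B ^ 2 - B - B + 1 by noncomm_ring]
  module

open Matrix in
theorem giesekus_entropy_production_nonneg (α : ℝ) (hα0 : 0 < α) (hα1 : α < 1)
    (B : Matrix (Fin 3) (Fin 3) ℝ) (hB : B.PosDef) :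
    0 ≤ (α • B ^ 2 + (1 - 3 * α) • B - (2 - 3 * α) • (1 : Matrix (Fin 3) (Fin 3) ℝ)
          + (1 - α) • B⁻¹).trace ∧
    ((α • B ^ 2 + (1 - 3 * α) • B - (2 - 3 * α) • (1 : Matrix (Fin 3) (Fin 3) ℝ)
          + (1 - α) • B⁻¹).trace = 0 ↔ B = 1) := by
  rw [giesekus_entropy_production_eq α hB, trace_add, trace_smul, trace_smul, smul_eq_mul,
    smul_eq_mul]
  have h₁ : 0 ≤ α * ((B - 1)ᴴ * (B - 1)).trace :=
    mul_nonneg hα0.le (posSemidef_conjTranspose_mul_self (B - 1)).trace_nonneg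
  have h₂ : 0 ≤ (1 - α) * ((B - 1)ᴴ * B⁻¹ * (B - 1)).trace :=
    mul_nonneg (sub_nonneg.2 hα1.le)
      (hB.inv.posSemidef.conjTranspose_mul_mul_same (B - 1)).trace_nonneg
  refine ⟨add_nonneg h₁ h₂, fun h => ?_, fun h => by simp [h]⟩
  have h₀ := ((add_eq_zero_iff_of_nonneg h₁ h₂).1 h).1
  exact sub_eq_zero.1 <| trace_conjTranspose_mul_self_eq_zero_iff.1 <|
    (mul_eq_zero.1 h₀).resolve_left hα0.ne'
end

section
/- Let α be a real number with 0 < α < 1 and let B be a symmetric positive definite real 3×3 matrix. Then Tr(B) − 3 − log(det B) ≤ (1/(1 − α))·Tr(α·B² + (1 − 3α)·B − (2 − 3α)·I + (1 − α)·B⁻¹), i.e. the stability inequality for the Giesekus model holds with constant C = 1/(1 − α). -/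
/-- The trace of the square of a real symmetric matrix is nonnegative. -/
theorem Matrix.IsHermitian.trace_sq_nonneg {n : Type*} [Fintype n] [DecidableEq n]
    {A : Matrix n n ℝ} (hA : A.IsHermitian) : 0 ≤ (A ^ 2).trace := by
  have h := (Matrix.posSemidef_conjTranspose_mul_self A).trace_nonneg
  rwa [hA.eq, ← sq] at h

theorem giesekus_stability_inequality (α : ℝ) (hα0 : 0 < α) (hα1 : α < 1)
    (B : Matrix (Fin 3) (Fin 3) ℝ) (hB : B.PosDef) :
    B.trace - 3 - Real.log B.det ≤
      (1 / (1 - α)) * (α • B ^ 2 + (1 - 3 * α) • B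
        - (2 - 3 * α) • (1 : Matrix (Fin 3) (Fin 3) ℝ) + (1 - α) • B⁻¹).trace := by
  have hlog := hB.inv.log_det_le_trace_sub_card
  rw [Matrix.det_nonsing_inv, Ring.inverse_eq_inv', Real.log_inv] at hlog
  have hsq := (hB.isHermitian.sub Matrix.isHermitian_one).trace_sq_nonneg
  have hexpand : (B - 1) ^ 2 = B ^ 2 - (2 : ℝ) • B + 1 := by
    rw [two_smul]
    noncomm_ring
  rw [hexpand] at hsq
  simp only [Matrix.trace_add, Matrix.trace_sub, Matrix.trace_smul, Matrix.trace_one,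
    Fintype.card_fin, smul_eq_mul, Nat.cast_ofNat] at hlog hsq ⊢
  have hα : 0 < 1 - α := sub_pos.mpr hα1
  rw [one_div, ← div_eq_inv_mul, le_div_iff₀ hα]
  nlinarith [mul_nonneg hα0.le hsq, mul_le_mul_of_nonneg_left hlog hα.le]
end

section
/- Let b > 3 be a real number and let B be a symmetric positive definite real 3×3 matrix with Tr(B) < b. Then −b·log(1 − Tr(B)/b) + b·log(1 − 3/b) − (1 − 3/b)^(−1)·log(det B) ≥ 0, with equality if and only if B is the identity matrix. -/
/-- Equality in `log det A ≤ tr A - n` forces `A = 1`. -/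
theorem Matrix.PosDef.eq_one_of_log_det_eq {n : Type*} [Fintype n] [DecidableEq n]
    {A : Matrix n n ℝ} (hA : A.PosDef) (h : Real.log A.det = A.trace - Fintype.card n) :
    A = 1 := by
  have hdet := hA.isHermitian.det_eq_prod_eigenvalues
  have htrace := hA.isHermitian.trace_eq_sum_eigenvalues
  simp only [RCLike.ofReal_real_eq_id, id_eq] at hdet htrace
  rw [hdet, htrace, Real.log_prod fun i _ => (hA.eigenvalues_pos i).ne'] at h
  have hsum : ∑ i, Real.log (hA.isHermitian.eigenvalues i) =
      ∑ i, (hA.isHermitian.eigenvalues i - 1) := by simpa using h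
  have heq := (Finset.sum_eq_sum_iff_of_le fun i _ =>
    Real.log_le_sub_one_of_pos (hA.eigenvalues_pos i)).mp hsum
  have hone : hA.isHermitian.eigenvalues = 1 := by
    funext i
    by_contra hi
    exact (Real.log_lt_sub_one_of_pos (hA.eigenvalues_pos i) hi).ne (heq i (Finset.mem_univ i))
  rw [hA.isHermitian.spectral_theorem, hone]
  have hdiag : Matrix.diagonal ((RCLike.ofReal : ℝ → ℝ) ∘ (1 : n → ℝ)) = 1 := by
    ext i j
    simp [Matrix.diagonal_apply, Matrix.one_apply]
  rw [hdiag, map_one]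

theorem fene_p_free_energy_nonneg (b : ℝ) (hb : 3 < b)
    (B : Matrix (Fin 3) (Fin 3) ℝ) (hB : B.PosDef) (htr : B.trace < b) :
    0 ≤ -(b * Real.log (1 - B.trace / b)) + b * Real.log (1 - 3 / b)
        - (1 - 3 / b)⁻¹ * Real.log B.det ∧
    (-(b * Real.log (1 - B.trace / b)) + b * Real.log (1 - 3 / b)
        - (1 - 3 / b)⁻¹ * Real.log B.det = 0 ↔ B = 1) := by
  have hb0 : 0 < b := by linarith
  have h3 : 0 < 1 - 3 / b := sub_pos.mpr ((div_lt_one hb0).mpr hb)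
  have ht : 0 < 1 - B.trace / b := sub_pos.mpr ((div_lt_one hb0).mpr htr)
  have hspring : (1 - 3 / b)⁻¹ * (B.trace - 3) ≤
      -(b * Real.log (1 - B.trace / b)) + b * Real.log (1 - 3 / b) := by
    have hlog := Real.log_le_sub_one_of_pos (div_pos ht h3)
    rw [Real.log_div ht.ne' h3.ne'] at hlog
    have hmul := mul_le_mul_of_nonneg_left hlog hb0.le
    have hid : b * ((1 - B.trace / b) / (1 - 3 / b) - 1) =
        -((1 - 3 / b)⁻¹ * (B.trace - 3)) := by
      have h3' := h3.ne'
      rw [div_sub_one h3', div_eq_mul_inv]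
      field_simp
      ring
    linarith
  have hdet : Real.log B.det ≤ B.trace - 3 := by
    simpa using hB.log_det_le_trace_sub_card
  have hinv : 0 < (1 - 3 / b)⁻¹ := inv_pos.mpr h3
  have hmul := mul_le_mul_of_nonneg_left hdet hinv.le
  refine ⟨by linarith, fun h => ?_, ?_⟩
  · refine hB.eq_one_of_log_det_eq ?_
    have hle : B.trace - 3 ≤ Real.log B.det := le_of_mul_le_mul_left (by linarith) hinv
    simpa using le_antisymm hdet hle
  · rintro rfl
    simp
end

section
/- Let b > 3 be a real number and let B be a symmetric positive definite real 3×3 matrix with Tr(B) < b. Then Tr( (1 − Tr(B)/b)^(−2)·B − 2·(1 − Tr(B)/b)^(−1)·(1 − 3/b)^(−1)·I + (1 − 3/b)^(−2)·B⁻¹ ) ≥ 0. -/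
open scoped Matrix in
/-- The matrix `a² B - 2ac I + c² B⁻¹` is the congruence of `B` by `a I - c B⁻¹`. -/
lemma Matrix.PosDef.posSemidef_sq_smul_sub_add_inv {n : Type*} [Fintype n] [DecidableEq n]
    {B : Matrix n n ℝ} (hB : B.PosDef) (a c : ℝ) :
    (a ^ 2 • B - (2 * a * c) • (1 : Matrix n n ℝ) + c ^ 2 • B⁻¹).PosSemidef := by
  have hdet : IsUnit B.det := hB.det_pos.ne'.isUnit
  have hherm : (a • (1 : Matrix n n ℝ) - c • B⁻¹)ᴴ = a • (1 : Matrix n n ℝ) - c • B⁻¹ := by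
    rw [Matrix.conjTranspose_sub, Matrix.conjTranspose_smul, Matrix.conjTranspose_smul,
      hB.isHermitian.inv.eq, Matrix.conjTranspose_one, star_trivial, star_trivial]
  have h := hB.posSemidef.conjTranspose_mul_mul_same (a • (1 : Matrix n n ℝ) - c • B⁻¹)
  rw [hherm] at h
  convert h using 1
  simp only [sub_mul, mul_sub, Matrix.smul_mul, Matrix.mul_smul, Matrix.one_mul, Matrix.mul_one,
    Matrix.nonsing_inv_mul B hdet, Matrix.mul_nonsing_inv B hdet]
  module

theorem fene_p_entropy_production_nonneg (b : ℝ) (hb : 3 < b)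
    (B : Matrix (Fin 3) (Fin 3) ℝ) (hB : B.PosDef) (htr : B.trace < b) :
    0 ≤ ((1 - B.trace / b)⁻¹ ^ 2 • B
          - (2 * (1 - B.trace / b)⁻¹ * (1 - 3 / b)⁻¹) • (1 : Matrix (Fin 3) (Fin 3) ℝ)
          + (1 - 3 / b)⁻¹ ^ 2 • B⁻¹).trace := by
  exact (hB.posSemidef_sq_smul_sub_add_inv _ _).trace_nonneg
end

section
/- Let b > 3 be a real number and let B be a symmetric positive definite real 3×3 matrix with Tr(B) < b. Then −b·log(1 − Tr(B)/b) + b·log(1 − 3/b) − (1 − 3/b)^(−1)·log(det B) ≤ (1 − 3/b)·Tr( (1 − Tr(B)/b)^(−2)·B − 2·(1 − Tr(B)/b)^(−1)·(1 − 3/b)^(−1)·I + (1 − 3/b)^(−2)·B⁻¹ ), i.e. the stability inequality for the FENE-P model holds with constant C = 1 − 3/b. -/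
theorem fene_p_stability_inequality (b : ℝ) (hb : 3 < b)
    (B : Matrix (Fin 3) (Fin 3) ℝ) (hB : B.PosDef) (htr : B.trace < b) :
    -(b * Real.log (1 - B.trace / b)) + b * Real.log (1 - 3 / b)
      - (1 - 3 / b)⁻¹ * Real.log B.det ≤
    (1 - 3 / b) * ((1 - B.trace / b)⁻¹ ^ 2 • B
          - (2 * (1 - B.trace / b)⁻¹ * (1 - 3 / b)⁻¹) • (1 : Matrix (Fin 3) (Fin 3) ℝ)
          + (1 - 3 / b)⁻¹ ^ 2 • B⁻¹).trace := by
  have hb0 : 0 < b := by linarith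
  have hdet := hB.inv.log_det_le_trace_sub_card
  rw [Matrix.det_nonsing_inv, Ring.inverse_eq_inv', Real.log_inv, Fintype.card_fin] at hdet
  push_cast at hdet
  simp only [Matrix.trace_add, Matrix.trace_sub, Matrix.trace_smul, Matrix.trace_one,
    Fintype.card_fin, smul_eq_mul, Nat.cast_ofNat]
  have ha : 0 < 1 - 3 / b := sub_pos.2 ((div_lt_one hb0).2 hb)
  have hp : 0 < 1 - B.trace / b := sub_pos.2 ((div_lt_one hb0).2 htr)
  have ht : B.trace = b * (1 - (1 - B.trace / b)) := by field_simp; ring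
  have h3 : (3 : ℝ) = b * (1 - (1 - 3 / b)) := by field_simp; ring
  generalize 1 - B.trace / b = p at *
  generalize 1 - 3 / b = a at *
  have hlog := Real.log_le_sub_one_of_pos (div_pos ha hp)
  rw [Real.log_div ha.ne' hp.ne'] at hlog
  have hlogb := mul_le_mul_of_nonneg_left hlog hb0.le
  have hdeta := mul_le_mul_of_nonneg_left hdet (inv_pos.2 ha).le
  have hsq : 0 ≤ b * ((a / p - 1) ^ 2 / a) := by positivity
  have key : a * (p⁻¹ ^ 2 * B.trace - 2 * p⁻¹ * a⁻¹ * 3 + a⁻¹ ^ 2 * B⁻¹.trace) =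
      b * ((a / p - 1) ^ 2 / a) + b * (a / p - 1) + a⁻¹ * (B⁻¹.trace - 3) := by
    rw [ht, h3]
    field_simp
    ring
  rw [key]
  linarith
end

section
/- Let p > 0 be a real number and let B be a symmetric positive definite real 3×3 matrix. Then Tr(B) − 3 − log(det B) ≤ exp(3p)·exp(p·Tr(B − I))·Tr(B − 2·I + B⁻¹), i.e. the stability inequality for the exponential Phan–Thien–Tanner model holds with constant C = exp(3p). -/
theorem ptt_stability_inequality (p : ℝ) (hp : 0 < p)
    (B : Matrix (Fin 3) (Fin 3) ℝ) (hB : B.PosDef) :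
    B.trace - 3 - Real.log B.det ≤
      Real.exp (3 * p) * Real.exp (p * (B - 1).trace) *
        (B - 2 • (1 : Matrix (Fin 3) (Fin 3) ℝ) + B⁻¹).trace := by
  have hB_log := hB.log_det_le_trace_sub_card
  have hinv_log := hB.inv.log_det_le_trace_sub_card
  rw [Matrix.det_nonsing_inv, Ring.inverse_eq_inv', Real.log_inv] at hinv_log
  have htrace : (B - 2 • (1 : Matrix (Fin 3) (Fin 3) ℝ) + B⁻¹).trace =
      B.trace - 6 + B⁻¹.trace := by
    rw [Matrix.trace_add, Matrix.trace_sub, Matrix.trace_smul, Matrix.trace_one]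
    norm_num
  have hfactor : 1 ≤ Real.exp (3 * p) * Real.exp (p * (B - 1).trace) := by
    rw [← Real.exp_add, Real.one_le_exp_iff, Matrix.trace_sub, Matrix.trace_one]
    have := mul_pos hp hB.trace_pos
    norm_num
    linarith
  rw [htrace]
  norm_num at hB_log hinv_log
  calc B.trace - 3 - Real.log B.det ≤ B.trace - 6 + B⁻¹.trace := by linarith
    _ ≤ _ := le_mul_of_one_le_left (by linarith) hfactor
end
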